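/- arXiv:2503.12176 — 2 statements merged into one kernel-verified Lean document; each statement's English description precedes it below -/
import Mathlib

section
/- (Theorem 3.3(iv)) Let the sequences (xᵏ, yᵏ, uᵏ, θ_k) be generated by the FPSA iteration and let 0 < m ≤ f(Kxᵏ) for all k. Then lim_{k→∞} (⟨Kxᵏ⁺¹, yᵏ⁺¹⟩ − f*(yᵏ⁺¹)) / f(Kxᵏ) = 1. -/
open Filter Metric Set RealInnerProductSpace
open scoped Topology Classical

noncomputable section

/-- Convexity for extended-real-valued functions. -/
def ERealConvex {α : Type*} [AddCommGroup α] [Module ℝ α] (f : α → EReal) : Prop :=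
  ∀ x y : α, ∀ a b : ℝ, 0 ≤ a → 0 ≤ b → a + b = 1 →
    f (a • x + b • y) ≤ (a : EReal) * f x + (b : EReal) * f y

/-- A proper extended-real-valued function: never `⊥` and finite somewhere. -/
def ERealProper {α : Type*} (f : α → EReal) : Prop :=
  (∀ x, f x ≠ ⊥) ∧ ∃ x, f x ≠ ⊤

/-- Effective domain of an extended-real-valued function. -/
def edom {α : Type*} (f : α → EReal) : Set α := {x | f x ≠ ⊤}

/-- Convex (Fenchel) conjugate. -/
def econj {α : Type*} [NormedAddCommGroup α] [InnerProductSpace ℝ α]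
    (f : α → EReal) (y : α) : EReal :=
  ⨆ z, (((⟪z, y⟫ : ℝ) : EReal) - f z)

/-- Convex subdifferential. -/
def csubdiff {α : Type*} [NormedAddCommGroup α] [InnerProductSpace ℝ α]
    (f : α → EReal) (z : α) : Set α :=
  {v | ∀ w, f z + ((⟪v, w - z⟫ : ℝ) : EReal) ≤ f w}

/-- Normal cone of a convex set. -/
def normalCone {α : Type*} [NormedAddCommGroup α] [InnerProductSpace ℝ α]
    (S : Set α) (x : α) : Set α :=
  {v | ∀ z ∈ S, ⟪v, z - x⟫ ≤ 0}

/-- Calmness of an extended-real-valued function at a point of its domain. -/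
def ECalm {α : Type*} [NormedAddCommGroup α] (f : α → EReal) (y : α) : Prop :=
  f y ≠ ⊤ ∧ ∃ ϱ > (0:ℝ), ∃ ε > (0:ℝ), ∀ y' ∈ Metric.ball y ε,
    f y - ((ϱ * ‖y' - y‖ : ℝ) : EReal) ≤ f y' ∧ f y' ≤ f y + ((ϱ * ‖y' - y‖ : ℝ) : EReal)

/-- Fréchet subdifferential of an extended-real-valued function of one variable. -/
def fsub {α : Type*} [NormedAddCommGroup α] [InnerProductSpace ℝ α]
    (f : α → EReal) (x : α) : Set α :=
  {v | 0 ≤ Filter.liminf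
      (fun z => (f z - f x - ((⟪v, z - x⟫ : ℝ) : EReal)) * (((‖z - x‖)⁻¹ : ℝ) : EReal))
      (𝓝[≠] x)}

/-- Fréchet subdifferential of a function of two (inner-product-space) variables. -/
def fsub2 {α β : Type*} [NormedAddCommGroup α] [InnerProductSpace ℝ α]
    [NormedAddCommGroup β] [InnerProductSpace ℝ β]
    (Φ : α → β → EReal) (a : α) (b : β) : Set (α × β) :=
  {v | 0 ≤ Filter.liminf
      (fun w : α × β =>
        (Φ w.1 w.2 - Φ a b - ((⟪v.1, w.1 - a⟫ + ⟪v.2, w.2 - b⟫ : ℝ) : EReal)) *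
          (((‖w - (a, b)‖)⁻¹ : ℝ) : EReal))
      (𝓝[≠] (a, b))}

/-- Limiting (Mordukhovich) subdifferential of a function of two variables. -/
def lsub2 {α β : Type*} [NormedAddCommGroup α] [InnerProductSpace ℝ α]
    [NormedAddCommGroup β] [InnerProductSpace ℝ β]
    (Φ : α → β → EReal) (a : α) (b : β) : Set (α × β) :=
  {v | ∃ w : ℕ → α × β, ∃ vs : ℕ → α × β,
      Tendsto w atTop (𝓝 (a, b)) ∧
      Tendsto (fun k => Φ (w k).1 (w k).2) atTop (𝓝 (Φ a b)) ∧
      (∀ k, vs k ∈ fsub2 Φ (w k).1 (w k).2) ∧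
      Tendsto vs atTop (𝓝 v)}

/-- Fréchet subdifferential of a function of three variables. -/
def fsub3 {α β γ : Type*} [NormedAddCommGroup α] [InnerProductSpace ℝ α]
    [NormedAddCommGroup β] [InnerProductSpace ℝ β]
    [NormedAddCommGroup γ] [InnerProductSpace ℝ γ]
    (Φ : α → β → γ → EReal) (a : α) (b : β) (c : γ) : Set (α × β × γ) :=
  {v | 0 ≤ Filter.liminf
      (fun w : α × β × γ =>
        (Φ w.1 w.2.1 w.2.2 - Φ a b c -
          ((⟪v.1, w.1 - a⟫ + ⟪v.2.1, w.2.1 - b⟫ + ⟪v.2.2, w.2.2 - c⟫ : ℝ) : EReal)) *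
          (((‖w - (a, b, c)‖)⁻¹ : ℝ) : EReal))
      (𝓝[≠] (a, b, c))}

/-- Limiting (Mordukhovich) subdifferential of a function of three variables. -/
def lsub3 {α β γ : Type*} [NormedAddCommGroup α] [InnerProductSpace ℝ α]
    [NormedAddCommGroup β] [InnerProductSpace ℝ β]
    [NormedAddCommGroup γ] [InnerProductSpace ℝ γ]
    (Φ : α → β → γ → EReal) (a : α) (b : β) (c : γ) : Set (α × β × γ) :=
  {v | ∃ w : ℕ → α × β × γ, ∃ vs : ℕ → α × β × γ,
      Tendsto w atTop (𝓝 (a, b, c)) ∧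
      Tendsto (fun k => Φ (w k).1 (w k).2.1 (w k).2.2) atTop (𝓝 (Φ a b c)) ∧
      (∀ k, vs k ∈ fsub3 Φ (w k).1 (w k).2.1 (w k).2.2) ∧
      Tendsto vs atTop (𝓝 v)}

/-- A polyhedral set: a finite intersection of closed half-spaces. -/
def IsPolyhedral {α : Type*} [NormedAddCommGroup α] [InnerProductSpace ℝ α]
    (S : Set α) : Prop :=
  ∃ (m : ℕ) (a : Fin m → α) (b : Fin m → ℝ), S = {z | ∀ i, ⟪a i, z⟫ ≤ b i}

/-- The merit function φ(x,u) = g(x) + h(x) + ι_S(x) + (1/(2δ))‖x-u‖². -/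
def phiF {n : ℕ} (S : Set (EuclideanSpace ℝ (Fin n)))
    (g : EuclideanSpace ℝ (Fin n) → EReal) (h : EuclideanSpace ℝ (Fin n) → ℝ) (δ : ℝ)
    (x u : EuclideanSpace ℝ (Fin n)) : EReal :=
  g x + ((h x : ℝ) : EReal) + (if x ∈ S then (0 : EReal) else ⊤)
    + (((2 * δ)⁻¹ * ‖x - u‖ ^ 2 : ℝ) : EReal)

/-- ϑ(x,u) = φ(x,u)/f(Kx). -/
def varthetaF {n p : ℕ} (S : Set (EuclideanSpace ℝ (Fin n)))
    (g : EuclideanSpace ℝ (Fin n) → EReal) (h : EuclideanSpace ℝ (Fin n) → ℝ)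
    (f : EuclideanSpace ℝ (Fin p) → EReal)
    (K : EuclideanSpace ℝ (Fin n) →ₗ[ℝ] EuclideanSpace ℝ (Fin p)) (δ : ℝ)
    (x u : EuclideanSpace ℝ (Fin n)) : EReal :=
  phiF S g h δ x u / f (K x)

/-- ϖ(x,y,u) = φ(x,u)/(⟨Kx,y⟩ - f*(y)). -/
def varpiF {n p : ℕ} (S : Set (EuclideanSpace ℝ (Fin n)))
    (g : EuclideanSpace ℝ (Fin n) → EReal) (h : EuclideanSpace ℝ (Fin n) → ℝ)
    (f : EuclideanSpace ℝ (Fin p) → EReal)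
    (K : EuclideanSpace ℝ (Fin n) →ₗ[ℝ] EuclideanSpace ℝ (Fin p)) (δ : ℝ)
    (x : EuclideanSpace ℝ (Fin n)) (y : EuclideanSpace ℝ (Fin p))
    (u : EuclideanSpace ℝ (Fin n)) : EReal :=
  phiF S g h δ x u / (((⟪K x, y⟫ : ℝ) : EReal) - econj f y)

theorem ERealConvex.convexOn_toReal {α : Type*} [AddCommGroup α] [Module ℝ α] {f : α → EReal}
    (hf : ERealConvex f) (hbot : ∀ x, f x ≠ ⊥) :
    ConvexOn ℝ (edom f) fun z => (f z).toReal := by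
  have key : ∀ x ∈ edom f, ∀ y ∈ edom f, ∀ a b : ℝ, 0 ≤ a → 0 ≤ b → a + b = 1 →
      f (a • x + b • y) ≤ ((a * (f x).toReal + b * (f y).toReal : ℝ) : EReal) := by
    intro x hx y hy a b ha hb hab
    have := hf x y a b ha hb hab
    rwa [← EReal.coe_toReal hx (hbot x), ← EReal.coe_toReal hy (hbot y), ← EReal.coe_mul,
      ← EReal.coe_mul, ← EReal.coe_add] at this
  refine ⟨fun x hx y hy a b ha hb hab =>
    ((key x hx y hy a b ha hb hab).trans_lt (EReal.coe_lt_top _)).ne,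
    fun x hx y hy a b ha hb hab => ?_⟩
  exact EReal.toReal_le_toReal (key x hx y hy a b ha hb hab) (hbot _) (EReal.coe_ne_top _)

/-- Equality in the Fenchel–Young inequality for subgradients. -/
theorem econj_eq_of_mem_csubdiff {α : Type*} [NormedAddCommGroup α] [InnerProductSpace ℝ α]
    {f : α → EReal} {z v : α} {a : ℝ} (ha : f z = a) (hv : v ∈ csubdiff f z) :
    econj f v = ((⟪z, v⟫ - a : ℝ) : EReal) := by
  refine le_antisymm (iSup_le fun w => ?_) ?_
  · have hw := hv w
    rw [ha, ← EReal.coe_add] at hw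
    refine (EReal.sub_le_sub le_rfl hw).trans ?_
    rw [← EReal.coe_sub, EReal.coe_le_coe_iff, inner_sub_right, real_inner_comm v w,
      real_inner_comm v z]
    linarith
  · refine le_trans ?_ (le_iSup (fun w => ((⟪w, v⟫ : ℝ) : EReal) - f w) z)
    rw [ha, EReal.coe_sub]

/-- A minimizer over a convex set of a convex function plus `q‖· - v‖²` satisfies a quadratic
growth inequality with the same constant `q`. -/
theorem ERealConvex.quadratic_growth {α : Type*} [NormedAddCommGroup α] [InnerProductSpace ℝ α]
    {g : α → EReal} (hg : ERealConvex g) {S : Set α} (hS : Convex ℝ S) {q : ℝ} {v a b : α}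
    (ha : a ∈ S) (hb : b ∈ S) {ga gb : ℝ} (hga : g a = ga) (hgb : g b = gb)
    (hmin : ∀ w ∈ S, g a + ((q * ‖a - v‖ ^ 2 : ℝ) : EReal) ≤
      g w + ((q * ‖w - v‖ ^ 2 : ℝ) : EReal)) :
    ga + q * ‖a - v‖ ^ 2 + q * ‖b - a‖ ^ 2 ≤ gb + q * ‖b - v‖ ^ 2 := by
  have key : ∀ t : ℝ, t ∈ Ioo (0 : ℝ) 1 →
      (1 - t) * (q * ‖b - a‖ ^ 2) ≤ gb + q * ‖b - v‖ ^ 2 - (ga + q * ‖a - v‖ ^ 2) := by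
    rintro t ⟨ht0, ht1⟩
    have hw := (hmin _ (hS ha hb (sub_nonneg.2 ht1.le) ht0.le (by ring))).trans
      (add_le_add_left (hg a b (1 - t) t (sub_nonneg.2 ht1.le) ht0.le (by ring)) _)
    rw [hga, hgb] at hw
    norm_cast at hw
    have e : ‖(1 - t) • a + t • b - v‖ ^ 2 =
        (1 - t) * ‖a - v‖ ^ 2 + t * ‖b - v‖ ^ 2 - t * (1 - t) * ‖b - a‖ ^ 2 := by
      have e1 : (1 - t) • a + t • b - v = (1 - t) • (a - v) + t • (b - v) := by module
      have e2 : b - a = (b - v) - (a - v) := by abel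
      rw [e1, e2, norm_add_sq_real, norm_sub_sq_real (b - v) (a - v), norm_smul, norm_smul, mul_pow, mul_pow,
        Real.norm_eq_abs, Real.norm_eq_abs, sq_abs, sq_abs, real_inner_smul_left,
        real_inner_smul_right, real_inner_comm (a - v) (b - v)]
      ring
    rw [e] at hw
    refine le_of_mul_le_mul_left ?_ ht0
    linarith
  have hlim : Tendsto (fun t : ℝ => (1 - t) * (q * ‖b - a‖ ^ 2)) (𝓝[>] 0)
      (𝓝 ((1 - 0) * (q * ‖b - a‖ ^ 2))) :=
    ((continuous_const.sub continuous_id).mul continuous_const).continuousAt.tendsto.mono_left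
      nhdsWithin_le_nhds
  have := le_of_tendsto hlim
    (mem_of_superset (Ioo_mem_nhdsGT (zero_lt_one' ℝ)) key)
  linarith

/-- The descent lemma on a convex set for a function with Lipschitz gradient. -/
theorem descent_of_lipschitz_gradient {α : Type*} [NormedAddCommGroup α] [InnerProductSpace ℝ α]
    [CompleteSpace α] {h : α → ℝ} {gh : α → α} {S : Set α} (hS : Convex ℝ S) {L : ℝ}
    (hgrad : ∀ z ∈ S, HasGradientAt h (gh z) z)
    (hlip : ∀ z ∈ S, ∀ w ∈ S, ‖gh z - gh w‖ ≤ L * ‖z - w‖) {a b : α} (ha : a ∈ S) (hb : b ∈ S) :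
    h b ≤ h a + ⟪gh a, b - a⟫ + L / 2 * ‖b - a‖ ^ 2 := by
  have hmem : ∀ t ∈ Icc (0 : ℝ) 1, a + t • (b - a) ∈ S := fun t ht =>
    hS.add_smul_sub_mem ha hb ht
  let ψ : ℝ → ℝ := fun t => h (a + t • (b - a)) - t * ⟪gh a, b - a⟫ - t ^ 2 * (L / 2 * ‖b - a‖ ^ 2)
  have hder : ∀ t ∈ Icc (0 : ℝ) 1, HasDerivAt ψ
      (⟪gh (a + t • (b - a)), b - a⟫ - ⟪gh a, b - a⟫ - 2 * t * (L / 2 * ‖b - a‖ ^ 2)) t := by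
    intro t ht
    have h1 : HasDerivAt (fun t : ℝ => a + t • (b - a)) (b - a) t := by
      simpa using ((hasDerivAt_id t).smul_const (b - a)).const_add a
    have h2 := (hgrad _ (hmem t ht)).hasFDerivAt.comp_hasDerivAt t h1
    have h3 := (h2.sub ((hasDerivAt_id t).mul_const ⟪gh a, b - a⟫)).sub
      ((hasDerivAt_pow 2 t).mul_const (L / 2 * ‖b - a‖ ^ 2))
    refine HasDerivAt.congr_deriv (f := ψ) h3 ?_
    simp
  have hanti : AntitoneOn ψ (Icc 0 1) := by
    refine antitoneOn_of_deriv_nonpos (convex_Icc 0 1)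
      (fun t ht => (hder t ht).continuousAt.continuousWithinAt)
      (fun t ht => (hder t (interior_subset ht)).differentiableAt.differentiableWithinAt)
      fun t ht => ?_
    have ht' : t ∈ Icc (0 : ℝ) 1 := interior_subset ht
    rw [(hder t ht').deriv, ← inner_sub_left]
    have h1 := real_inner_le_norm (gh (a + t • (b - a)) - gh a) (b - a)
    have h2 := hlip _ (hmem t ht') a ha
    rw [add_sub_cancel_left, norm_smul, Real.norm_of_nonneg ht'.1] at h2
    nlinarith [mul_le_mul_of_nonneg_right h2 (norm_nonneg (b - a))]
  have := hanti (left_mem_Icc.2 zero_le_one) (right_mem_Icc.2 zero_le_one) zero_le_one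
  simp only [ψ, one_smul, zero_smul, add_sub_cancel, add_zero] at this
  linarith

/-- A proper convex function is bounded above on some closed neighbourhood of a compact subset of
the interior of its domain, and its subgradients are uniformly bounded on that compact set. -/
theorem ERealConvex.exists_bound_of_isCompact {α : Type*} [NormedAddCommGroup α]
    [InnerProductSpace ℝ α] [FiniteDimensional ℝ α] {f : α → EReal} (hf : ERealConvex f)
    (hbot : ∀ x, f x ≠ ⊥) {C : Set α} (hC : IsCompact C) (hCf : C ⊆ interior (edom f)) :
    ∃ M : ℝ, (∀ z ∈ C, (f z).toReal ≤ M) ∧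
      ∃ B : ℝ, ∀ z ∈ C, 0 ≤ f z → ∀ v ∈ csubdiff f z, ‖v‖ ≤ B := by
  obtain ⟨ε, hε, hsub⟩ := hC.exists_cthickening_subset_open isOpen_interior hCf
  have : ProperSpace α := FiniteDimensional.proper ℝ α
  obtain ⟨M, hM⟩ := hC.cthickening.bddAbove_image
    (((hf.convexOn_toReal hbot).continuousOn_interior).mono hsub)
  have hM' : ∀ z ∈ cthickening ε C, (f z).toReal ≤ M := fun z hz => hM (mem_image_of_mem _ hz)
  refine ⟨M, fun z hz => hM' z (self_subset_cthickening C hz), M / ε, fun z hz h0 v hv => ?_⟩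
  have hdom : ∀ w ∈ cthickening ε C, f w = ((f w).toReal : EReal) := fun w hw =>
    (EReal.coe_toReal (interior_subset (hsub hw)) (hbot w)).symm
  have hfz := hdom z (self_subset_cthickening C hz)
  have hz0 : 0 ≤ (f z).toReal := EReal.toReal_nonneg h0
  rcases eq_or_ne v 0 with rfl | hv0
  · rw [norm_zero]
    exact div_nonneg (hz0.trans (hM' z (self_subset_cthickening C hz))) hε.le
  have hvn : 0 < ‖v‖ := norm_pos_iff.2 hv0
  set w := z + (ε / ‖v‖) • v with hw
  have hwz : w - z = (ε / ‖v‖) • v := add_sub_cancel_left _ _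
  have hwC : w ∈ cthickening ε C := by
    refine mem_cthickening_of_dist_le w z ε C hz ?_
    rw [dist_eq_norm, hwz, norm_smul, Real.norm_of_nonneg (by positivity)]
    exact (div_mul_cancel₀ _ hvn.ne').le
  have h1 := hv w
  rw [hfz, hdom w hwC, ← EReal.coe_add, EReal.coe_le_coe_iff, hwz, real_inner_smul_right,
    real_inner_self_eq_norm_sq] at h1
  have h2 : ε / ‖v‖ * ‖v‖ ^ 2 = ‖v‖ * ε := by field_simp
  rw [le_div_iff₀ hε]
  linarith [hM' w hwC]

theorem stmt9 {n p : ℕ}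
    (S : Set (EuclideanSpace ℝ (Fin n)))
    (g : EuclideanSpace ℝ (Fin n) → EReal)
    (h : EuclideanSpace ℝ (Fin n) → ℝ)
    (gh : EuclideanSpace ℝ (Fin n) → EuclideanSpace ℝ (Fin n))
    (f : EuclideanSpace ℝ (Fin p) → EReal)
    (K : EuclideanSpace ℝ (Fin n) →ₗ[ℝ] EuclideanSpace ℝ (Fin p))
    (L δ : ℝ)
    (hS : S.Nonempty) (hSconv : Convex ℝ S) (hScomp : IsCompact S)
    (hgP : ERealProper g) (hgconv : ERealConvex g) (hglsc : LowerSemicontinuous g)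
    (hfP : ERealProper f) (hfconv : ERealConvex f) (hflsc : LowerSemicontinuous f)
    (hL : 0 < L)
    (hhC1 : ∃ O : Set (EuclideanSpace ℝ (Fin n)), IsOpen O ∧ S ⊆ O ∧
      (∀ z ∈ O, HasGradientAt h (gh z) z) ∧
      (∀ z ∈ O, ∀ w ∈ O, ‖gh z - gh w‖ ≤ L * ‖z - w‖))
    (hKS : ∀ z ∈ S, K z ∈ interior (edom f))
    (hfpos : ∀ z ∈ S, (0 : EReal) < f (K z))
    (hghnn : ∀ z ∈ S, (0 : EReal) ≤ g z + ((h z : ℝ) : EReal))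
    (hSg : ∃ z ∈ S, g z ≠ ⊤)
    (hδ : 0 < δ) (hδL : δ < 1 / L)
    (σ : ℝ) (hσ : 0 < σ) (hσ2 : σ < 2)
    (x u : ℕ → EuclideanSpace ℝ (Fin n)) (y : ℕ → EuclideanSpace ℝ (Fin p)) (θ : ℕ → ℝ)
    (hxS : ∀ k, x k ∈ S ∧ g (x k) ≠ ⊤)
    (hy : ∀ k, y (k+1) ∈ csubdiff f (K (x k)))
    (hxmin : ∀ k, ∀ w ∈ S,
      g (x (k+1)) + (((2*δ)⁻¹ * ‖x (k+1) - u k + δ • gh (x k)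
          - (θ k * δ) • (LinearMap.adjoint K) (y (k+1))‖ ^ 2 : ℝ) : EReal)
        ≤ g w + (((2*δ)⁻¹ * ‖w - u k + δ • gh (x k)
          - (θ k * δ) • (LinearMap.adjoint K) (y (k+1))‖ ^ 2 : ℝ) : EReal))
    (hu : ∀ k, u (k+1) = (1 - σ) • u k + σ • x (k+1))
    (hθ : ∀ k, (θ k : EReal) = varthetaF S g h f K δ (x k) (u k))
    (hθnn : ∀ k, 0 ≤ θ k)
    (m : ℝ) (hm : 0 < m)
    (hmf : ∀ k, (m : EReal) ≤ f (K (x k)))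
    :
    Tendsto (fun k =>
        ((((⟪K (x (k+1)), y (k+1)⟫ : ℝ) : EReal) - econj f (y (k+1))).toReal
          / (f (K (x k))).toReal)) atTop (𝓝 1) := by
  have hfr : ∀ z ∈ S, f (K z) = ((f (K z)).toReal : EReal) := fun z hz =>
    (EReal.coe_toReal (interior_subset (hKS z hz)) (hfP.1 _)).symm
  have hFpos : ∀ z ∈ S, 0 < (f (K z)).toReal := fun z hz =>
    EReal.toReal_pos (hfpos z hz) (interior_subset (hKS z hz))
  have hgr : ∀ k, g (x k) = ((g (x k)).toReal : EReal) := fun k =>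
    (EReal.coe_toReal (hxS k).2 (hgP.1 _)).symm
  have hKcont : Continuous K := K.continuous_of_finiteDimensional
  obtain ⟨M, hM, B, hB⟩ := hfconv.exists_bound_of_isCompact hfP.1 (hScomp.image hKcont)
    (image_subset_iff.2 hKS)
  have hMk : ∀ k, (f (K (x k))).toReal ≤ M := fun k => hM _ (mem_image_of_mem _ (hxS k).1)
  have hBk : ∀ k, ‖y (k + 1)‖ ≤ B := fun k =>
    hB _ (mem_image_of_mem _ (hxS k).1) (hfpos _ (hxS k).1).le _ (hy k)
  have hmk : ∀ k, m ≤ (f (K (x k))).toReal := fun k => by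
    have := hmf k
    rwa [hfr _ (hxS k).1, EReal.coe_le_coe_iff] at this
  have hMpos : 0 < M := hm.trans_le ((hmk 0).trans (hMk 0))
  have hθr : ∀ k, θ k * (f (K (x k))).toReal =
      (g (x k)).toReal + h (x k) + (2 * δ)⁻¹ * ‖x k - u k‖ ^ 2 := by
    intro k
    have := hθ k
    rw [varthetaF, phiF, if_pos (hxS k).1, hgr k, hfr _ (hxS k).1, add_zero, ← EReal.coe_add,
      ← EReal.coe_add, ← EReal.coe_div, EReal.coe_eq_coe_iff] at this
    rw [this]
    exact div_mul_cancel₀ _ (hFpos _ (hxS k).1).ne'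
  set c : ℝ := (2 * δ)⁻¹ - L / 2 with hc
  have hcpos : 0 < c := by
    have : L * δ < 1 := by rwa [lt_div_iff₀ hL, mul_comm] at hδL
    have e : c = (1 - L * δ) / (2 * δ) := by rw [hc]; field_simp
    rw [e]
    exact div_pos (by linarith) (by linarith)
  obtain ⟨O, -, hSO, hgrad, hlip⟩ := hhC1
  have hdesc : ∀ k, c * ‖x (k + 1) - x k‖ ^ 2 ≤ M * (θ k - θ (k + 1)) := by
    intro k
    have hgrow := hgconv.quadratic_growth (q := (2 * δ)⁻¹)
      (v := u k - δ • gh (x k) + (θ k * δ) • LinearMap.adjoint K (y (k + 1))) hSconv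
      (hxS (k + 1)).1 (hxS k).1 (hgr (k + 1)) (hgr k) (fun w hw => by
        have e : ∀ w : EuclideanSpace ℝ (Fin n),
            w - (u k - δ • gh (x k) + (θ k * δ) • LinearMap.adjoint K (y (k + 1))) =
            w - u k + δ • gh (x k) - (θ k * δ) • LinearMap.adjoint K (y (k + 1)) := fun w => by
          abel
        rw [e, e]
        exact hxmin k w hw)
    have hh := descent_of_lipschitz_gradient hSconv (fun z hz => hgrad z (hSO hz))
      (fun z hz w hw => hlip z (hSO hz) w (hSO hw)) (hxS k).1 (hxS (k + 1)).1
    have hsub := hy k (K (x (k + 1)))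
    rw [hfr _ (hxS k).1, hfr _ (hxS (k + 1)).1, ← EReal.coe_add, EReal.coe_le_coe_iff,
      ← map_sub] at hsub
    have hexp : ∀ w : EuclideanSpace ℝ (Fin n), (2 * δ)⁻¹ *
        ‖w - (u k - δ • gh (x k) + (θ k * δ) • LinearMap.adjoint K (y (k + 1)))‖ ^ 2 =
        (2 * δ)⁻¹ * ‖w - u k‖ ^ 2 + (⟪gh (x k), w - u k⟫ - θ k * ⟪y (k + 1), K (w - u k)⟫) +
        (2 * δ)⁻¹ * ‖δ • gh (x k) - (θ k * δ) • LinearMap.adjoint K (y (k + 1))‖ ^ 2 := by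
      intro w
      have e : w - (u k - δ • gh (x k) + (θ k * δ) • LinearMap.adjoint K (y (k + 1))) =
          (w - u k) + (δ • gh (x k) - (θ k * δ) • LinearMap.adjoint K (y (k + 1))) := by abel
      rw [e, norm_add_sq_real, inner_sub_right, real_inner_smul_right, real_inner_smul_right,
        LinearMap.adjoint_inner_right, real_inner_comm, real_inner_comm (y (k + 1))]
      field_simp
    rw [hexp, hexp, norm_sub_rev (x k) (x (k + 1))] at hgrow
    have e1 : ⟪gh (x k), x (k + 1) - x k⟫ =
        ⟪gh (x k), x (k + 1) - u k⟫ - ⟪gh (x k), x k - u k⟫ := by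
      rw [← inner_sub_right, sub_sub_sub_cancel_right]
    have e2 : ⟪y (k + 1), K (x (k + 1) - x k)⟫ =
        ⟪y (k + 1), K (x (k + 1) - u k)⟫ - ⟪y (k + 1), K (x k - u k)⟫ := by
      rw [← inner_sub_right, ← map_sub, sub_sub_sub_cancel_right]
    have hu' : (2 * δ)⁻¹ * ‖x (k + 1) - u (k + 1)‖ ^ 2 ≤ (2 * δ)⁻¹ * ‖x (k + 1) - u k‖ ^ 2 := by
      have e : x (k + 1) - u (k + 1) = (1 - σ) • (x (k + 1) - u k) := by rw [hu k]; module
      rw [e, norm_smul, mul_pow, Real.norm_eq_abs, sq_abs]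
      have : (1 - σ) ^ 2 ≤ 1 := by nlinarith
      gcongr
      exact mul_le_of_le_one_left (sq_nonneg _) this
    have hθk := hθr k
    have hθk1 := hθr (k + 1)
    have hmul := mul_le_mul_of_nonneg_left hsub (hθnn k)
    have hF1 : c * ‖x (k + 1) - x k‖ ^ 2 ≤ (f (K (x (k + 1)))).toReal * (θ k - θ (k + 1)) := by
      rw [hc]
      rw [e1] at hh
      rw [e2] at hmul
      linarith
    have hnn : 0 ≤ θ k - θ (k + 1) :=
      nonneg_of_mul_nonneg_right (le_trans (by positivity) hF1) (hFpos _ (hxS (k + 1)).1)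
    exact hF1.trans (mul_le_mul_of_nonneg_right (hMk (k + 1)) hnn)
  have hθanti : Antitone θ := antitone_nat_of_succ_le fun k => by
    have : 0 ≤ M * (θ k - θ (k + 1)) := le_trans (by positivity) (hdesc k)
    linarith [nonneg_of_mul_nonneg_right this hMpos]
  have hθlim := tendsto_atTop_ciInf hθanti ⟨0, forall_mem_range.2 hθnn⟩
  have hdiff : Tendsto (fun k => M * (θ k - θ (k + 1)) / c) atTop (𝓝 0) := by
    simpa using ((hθlim.sub (hθlim.comp (tendsto_add_atTop_nat 1))).const_mul M).div_const c
  have hsq : Tendsto (fun k => ‖x (k + 1) - x k‖ ^ 2) atTop (𝓝 0) :=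
    squeeze_zero (fun k => sq_nonneg _)
      (fun k => by rw [le_div_iff₀ hcpos, mul_comm]; exact hdesc k) hdiff
  have hx0 : Tendsto (fun k => x (k + 1) - x k) atTop (𝓝 0) := by
    refine tendsto_zero_iff_norm_tendsto_zero.2 ?_
    simpa using hsq.sqrt
  have hK0 : Tendsto (fun k => ‖K (x (k + 1) - x k)‖) atTop (𝓝 0) := by
    simpa using ((hKcont.tendsto 0).comp hx0).norm
  have hq0 : Tendsto (fun k => ⟪K (x (k + 1) - x k), y (k + 1)⟫ / (f (K (x k))).toReal)
      atTop (𝓝 0) := by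
    refine squeeze_zero_norm (a := fun k => ‖K (x (k + 1) - x k)‖ * B / m) (fun k => ?_)
      (by simpa using (hK0.mul_const B).div_const m)
    rw [norm_div, Real.norm_of_nonneg (hFpos _ (hxS k).1).le]
    have hinner := (norm_inner_le_norm (𝕜 := ℝ) (K (x (k + 1) - x k)) (y (k + 1))).trans
      (mul_le_mul_of_nonneg_left (hBk k) (norm_nonneg _))
    exact div_le_div₀ ((norm_nonneg _).trans hinner) hinner hm (hmk k)
  refine (add_zero (1 : ℝ) ▸ hq0.const_add 1).congr fun k => ?_
  rw [econj_eq_of_mem_csubdiff (hfr _ (hxS k).1) (hy k), ← EReal.coe_sub, EReal.toReal_coe,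
    map_sub, inner_sub_left]
  have := (hFpos _ (hxS k).1).ne'
  field_simp
  ring
end
end

section
/- Suppose ri(S) ∩ ri(dom g) ≠ ∅ (or S polyhedral and S ∩ ri(dom g) ≠ ∅), and let f be differentiable at Kx ∈ int(dom f) for some x ∈ S and u ∈ ℝⁿ with α₁ := φ(x,u) > 0 and α₂ := f(Kx). Then the Fréchet subdifferential of ϑ at (x,u) is exactly the set of pairs (ξ_x, ξ_u) with ξ_x ∈ [α₂(∂g(x) + ∇h(x) + N_S(x) + (x − u)/δ) − α₁·Kᵀ∇f(Kx)] / f(Kx)² and ξ_u = (u − x)/(δ f(Kx)). -/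
open Filter Metric Set RealInnerProductSpace
open scoped Topology Classical

noncomputable section

theorem neg_div_le_div_of_affine {X : Type*} [AddCommGroup X] [Module ℝ X] {D : Set X} {G : X → ℝ}
    (hG : ConvexOn ℝ D G) (l : X →ᵃ[ℝ] ℝ) (h0 : ∀ x ∈ D, l x = 0 → 0 ≤ G x) {x y : X}
    (hx : x ∈ D) (hy : y ∈ D) (hlx : 0 < l x) (hly : l y < 0) :
    -G x / l x ≤ G y / (-l y) := by
  have hd : 0 < l x - l y := by linarith
  have hsum : -l y / (l x - l y) + l x / (l x - l y) = 1 := by field_simp; ring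
  have ha : 0 ≤ -l y / (l x - l y) := div_nonneg (by linarith) hd.le
  have hb : 0 ≤ l x / (l x - l y) := div_nonneg hlx.le hd.le
  have hlz : l ((-l y / (l x - l y)) • x + (l x / (l x - l y)) • y) = 0 := by
    rw [Convex.combo_affine_apply hsum]
    field_simp
    ring
  have h1 := h0 _ (hG.1 hx hy ha hb hsum) hlz
  have h2 := h1.trans (hG.2 hx hy ha hb hsum)
  have h3 : 0 ≤ (-l y * G x + l x * G y) / (l x - l y) := by
    refine h2.trans_eq ?_
    simp only [smul_eq_mul]
    ring
  have h4 : 0 ≤ -l y * G x + l x * G y := by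
    by_contra! hneg
    exact absurd h3 (not_le.2 (div_neg_of_neg_of_pos hneg hd))
  rw [div_le_div_iff₀ hlx (by linarith)]
  linarith

/-- A convex function that is nonnegative on the zero set of an affine function becomes nonnegative
after adding a suitable multiple of that function, provided that the affine function vanishes at
a relative algebraic interior point of the domain. -/
theorem exists_multiplier_of_eq {X : Type*} [AddCommGroup X] [Module ℝ X] {D : Set X} {G : X → ℝ}
    (hG : ConvexOn ℝ D G) {x₀ : X}
    (hcore : ∀ x ∈ D, ∃ ε > (0 : ℝ), x₀ + ε • (x₀ - x) ∈ D) (l : X →ᵃ[ℝ] ℝ) (hl : l x₀ = 0)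
    (h0 : ∀ x ∈ D, l x = 0 → 0 ≤ G x) :
    ∃ c : ℝ, ∀ x ∈ D, 0 ≤ G x + c * l x := by
  have key : ∀ x ∈ D, ∀ y ∈ D, 0 < l x → l y < 0 → -G x / l x ≤ G y / (-l y) :=
    fun x hx y hy => neg_div_le_div_of_affine hG l h0 hx hy
  have hopp : ∀ x ∈ D, ∃ ε > (0 : ℝ), ∃ y ∈ D, l y = -ε * l x := by
    intro x hx
    obtain ⟨ε, hε, hy⟩ := hcore x hx
    refine ⟨ε, hε, _, hy, ?_⟩
    have : x₀ + ε • (x₀ - x) = AffineMap.lineMap x₀ x (-ε) := by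
      rw [AffineMap.lineMap_apply_module']; module
    rw [this, AffineMap.apply_lineMap, AffineMap.lineMap_apply_module', hl]
    simp
  by_cases hpos : ∃ x ∈ D, 0 < l x
  · obtain ⟨x₁, hx₁, hlx₁⟩ := hpos
    obtain ⟨ε, hε, y₁, hy₁, hly₁⟩ := hopp x₁ hx₁
    have hneg₁ : l y₁ < 0 := by rw [hly₁]; nlinarith
    have hbdd : BddAbove ((fun x => -G x / l x) '' {x ∈ D | 0 < l x}) := by
      refine ⟨G y₁ / (-l y₁), ?_⟩
      rintro _ ⟨x, ⟨hx, hlx⟩, rfl⟩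
      exact key x hx y₁ hy₁ hlx hneg₁
    refine ⟨sSup ((fun x => -G x / l x) '' {x ∈ D | 0 < l x}), fun x hx => ?_⟩
    rcases lt_trichotomy (l x) 0 with hlx | hlx | hlx
    · have : sSup ((fun x => -G x / l x) '' {x ∈ D | 0 < l x}) ≤ G x / (-l x) := by
        refine csSup_le ⟨_, mem_image_of_mem _ ⟨hx₁, hlx₁⟩⟩ ?_
        rintro _ ⟨z, ⟨hz, hlz⟩, rfl⟩
        exact key z hz x hx hlz hlx
      rw [le_div_iff₀ (by linarith)] at this
      linarith
    · simpa [hlx] using h0 x hx hlx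
    · have := le_csSup hbdd (mem_image_of_mem _ ⟨hx, hlx⟩)
      rw [div_le_iff₀ hlx] at this
      linarith
  · push Not at hpos
    refine ⟨0, fun x hx => ?_⟩
    obtain ⟨ε, hε, y, hy, hly⟩ := hopp x hx
    have h1 := hpos x hx
    have h2 := hpos y hy
    have h3 : l x = 0 := by
      rw [hly] at h2
      nlinarith
    simpa using h0 x hx h3

/-- Lagrange multiplier for one affine inequality constraint under Slater's condition. -/
theorem exists_multiplier_of_slater {X : Type*} [AddCommGroup X] [Module ℝ X] {D : Set X}
    {G : X → ℝ} (hG : ConvexOn ℝ D G) (l : X →ᵃ[ℝ] ℝ) {y₁ : X} (hy₁ : y₁ ∈ D) (hly₁ : l y₁ < 0)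
    (h0 : ∀ x ∈ D, l x ≤ 0 → 0 ≤ G x) :
    ∃ c : ℝ, 0 ≤ c ∧ ∀ x ∈ D, 0 ≤ G x + c * l x := by
  have key : ∀ x ∈ D, ∀ y ∈ D, 0 < l x → l y < 0 → -G x / l x ≤ G y / (-l y) :=
    fun x hx y hy => neg_div_le_div_of_affine hG l (fun x hx h => h0 x hx h.le) hx hy
  let T : Set ℝ := insert 0 ((fun x => -G x / l x) '' {x ∈ D | 0 < l x})
  have hub : ∀ x ∈ D, l x < 0 → G x / (-l x) ∈ upperBounds T := by
    rintro x hx hlx _ (rfl | ⟨z, ⟨hz, hlz⟩, rfl⟩)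
    · exact div_nonneg (h0 x hx hlx.le) (by linarith)
    · exact key z hz x hx hlz hlx
  have hbdd : BddAbove T := ⟨_, hub y₁ hy₁ hly₁⟩
  refine ⟨sSup T, le_csSup hbdd (mem_insert _ _), fun x hx => ?_⟩
  rcases lt_trichotomy (l x) 0 with hlx | hlx | hlx
  · have := csSup_le (insert_nonempty _ _) (hub x hx hlx)
    rw [le_div_iff₀ (by linarith)] at this
    linarith
  · simpa [hlx] using h0 x hx hlx.le
  · have := le_csSup hbdd (mem_insert_of_mem _ (mem_image_of_mem _ ⟨hx, hlx⟩))
    rw [div_le_iff₀ hlx] at this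
    linarith

theorem convexOn_add_const_mul_affine {X : Type*} [AddCommGroup X] [Module ℝ X] {D : Set X}
    {G : X → ℝ} (hG : ConvexOn ℝ D G) (l : X →ᵃ[ℝ] ℝ) (c : ℝ) :
    ConvexOn ℝ D (fun x => G x + c * l x) := by
  refine hG.add ⟨hG.1, fun x _ y _ a b _ _ hab => ?_⟩
  beta_reduce
  rw [Convex.combo_affine_apply hab]
  simp only [smul_eq_mul]
  exact le_of_eq (by ring)

theorem convexOn_add_sum_mul_affine {X ι : Type*} [AddCommGroup X] [Module ℝ X] {D : Set X}
    {G : X → ℝ} (hG : ConvexOn ℝ D G) (l : ι → X →ᵃ[ℝ] ℝ) (c : ι → ℝ) (s : Finset ι) :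
    ConvexOn ℝ D (fun x => G x + ∑ i ∈ s, c i * l i x) := by
  induction s using Finset.induction_on with
  | empty => simpa using hG
  | insert a s ha ih =>
    convert convexOn_add_const_mul_affine ih (l a) (c a) using 2 with x
    rw [Finset.sum_insert ha]
    ring

/-- The slice of a set by a hyperplane through a relative algebraic interior point still has
that point in its relative algebraic interior. -/
theorem relative_core_inter_eq {X : Type*} [AddCommGroup X] [Module ℝ X] {D : Set X} {x₀ : X}
    (hcore : ∀ x ∈ D, ∃ ε > (0 : ℝ), x₀ + ε • (x₀ - x) ∈ D) (l : X →ᵃ[ℝ] ℝ) (hl : l x₀ = 0) :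
    ∀ x ∈ D ∩ {x | l x = 0}, ∃ ε > (0 : ℝ), x₀ + ε • (x₀ - x) ∈ D ∩ {x | l x = 0} := by
  rintro x ⟨hx, hlx⟩
  obtain ⟨ε, hε, h⟩ := hcore x hx
  refine ⟨ε, hε, h, ?_⟩
  have : x₀ + ε • (x₀ - x) = AffineMap.lineMap x₀ x (-ε) := by
    rw [AffineMap.lineMap_apply_module']; module
  rw [mem_ofPred_eq] at hlx ⊢
  rw [this, AffineMap.apply_lineMap, AffineMap.lineMap_apply_module', hl, hlx]
  simp

theorem convex_affine_eq {X : Type*} [AddCommGroup X] [Module ℝ X] (l : X →ᵃ[ℝ] ℝ) :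
    Convex ℝ {x | l x = 0} := by
  intro x hx y hy a b _ _ hab
  rw [mem_ofPred_eq] at hx hy ⊢
  rw [Convex.combo_affine_apply hab, hx, hy]
  simp

theorem convex_affine_le {X : Type*} [AddCommGroup X] [Module ℝ X] (l : X →ᵃ[ℝ] ℝ) :
    Convex ℝ {x | l x ≤ 0} :=
  (convex_Iic (0 : ℝ)).affine_preimage l

/-- Lagrange multipliers for finitely many affine equality constraints. -/
theorem exists_multipliers_of_eq {X ι : Type*} [AddCommGroup X] [Module ℝ X]
    (l : ι → X →ᵃ[ℝ] ℝ) {x₀ : X} (s : Finset ι) :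
    ∀ (D : Set X) (G : X → ℝ), ConvexOn ℝ D G →
      (∀ x ∈ D, ∃ ε > (0 : ℝ), x₀ + ε • (x₀ - x) ∈ D) → (∀ i ∈ s, l i x₀ = 0) →
      (∀ x ∈ D, (∀ i ∈ s, l i x = 0) → 0 ≤ G x) →
      ∃ c : ι → ℝ, ∀ x ∈ D, 0 ≤ G x + ∑ i ∈ s, c i * l i x := by
  induction s using Finset.induction_on with
  | empty =>
    intro D G _ _ _ h0
    exact ⟨0, fun x hx => by simpa using h0 x hx (by simp)⟩
  | insert a s ha ih =>
    intro D G hG hcore hl h0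
    have hla := hl a (Finset.mem_insert_self a s)
    obtain ⟨c, hc⟩ := ih (D ∩ {x | l a x = 0}) G
      (hG.subset inter_subset_left (hG.1.inter (convex_affine_eq _)))
      (relative_core_inter_eq hcore _ hla) (fun i hi => hl i (Finset.mem_insert_of_mem hi))
      (fun x hx h => h0 x hx.1 (Finset.forall_mem_insert _ _ _ |>.2 ⟨hx.2, h⟩))
    obtain ⟨d, hd⟩ := exists_multiplier_of_eq (G := fun x => G x + ∑ i ∈ s, c i * l i x)
      (convexOn_add_sum_mul_affine hG l c s) hcore (l a) hla (fun x hx h => hc x ⟨hx, h⟩)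
    refine ⟨Function.update c a d, fun x hx => ?_⟩
    have := hd x hx
    rw [Finset.sum_insert ha, Function.update_self,
      Finset.sum_congr rfl fun i hi => by
        rw [Function.update_of_ne (ne_of_mem_of_not_mem hi ha)]]
    linarith

/-- Lagrange multipliers for finitely many affine inequality constraints, feasible at a
relative algebraic interior point of the domain. -/
theorem exists_multipliers_of_le {X ι : Type*} [AddCommGroup X] [Module ℝ X]
    (l : ι → X →ᵃ[ℝ] ℝ) {x₀ : X} (s : Finset ι) :
    ∀ (D : Set X) (G : X → ℝ), ConvexOn ℝ D G → x₀ ∈ D →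
      (∀ x ∈ D, ∃ ε > (0 : ℝ), x₀ + ε • (x₀ - x) ∈ D) → (∀ i ∈ s, l i x₀ ≤ 0) →
      (∀ x ∈ D, (∀ i ∈ s, l i x ≤ 0) → 0 ≤ G x) →
      ∃ c : ι → ℝ, (∀ i ∈ s, 0 ≤ c i) ∧ ∀ x ∈ D, 0 ≤ G x + ∑ i ∈ s, c i * l i x := by
  induction s using Finset.induction_on with
  | empty =>
    intro D G _ _ _ _ h0
    exact ⟨0, by simp, fun x hx => by simpa using h0 x hx (by simp)⟩
  | insert a s ha ih =>
    intro D G hG hx₀ hcore hl h0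
    have hls : ∀ i ∈ s, l i x₀ ≤ 0 := fun i hi => hl i (Finset.mem_insert_of_mem hi)
    have combine : ∀ (c : ι → ℝ) (d : ℝ), 0 ≤ d → (∀ i ∈ s, 0 ≤ c i) →
        (∀ x ∈ D, 0 ≤ G x + d * l a x + ∑ i ∈ s, c i * l i x) →
        ∃ c : ι → ℝ, (∀ i ∈ insert a s, 0 ≤ c i) ∧
          ∀ x ∈ D, 0 ≤ G x + ∑ i ∈ insert a s, c i * l i x := by
      intro c d hd hc h
      refine ⟨Function.update c a d, (Finset.forall_mem_insert _ _ _).2 ⟨by simpa, fun i hi => ?_⟩,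
        fun x hx => ?_⟩
      · rw [Function.update_of_ne (ne_of_mem_of_not_mem hi ha)]
        exact hc i hi
      · have := h x hx
        rw [Finset.sum_insert ha, Function.update_self,
          Finset.sum_congr rfl fun i hi => by
            rw [Function.update_of_ne (ne_of_mem_of_not_mem hi ha)]]
        linarith
    by_cases hsl : ∃ y ∈ D, (∀ i ∈ s, l i y ≤ 0) ∧ l a y < 0
    · obtain ⟨y, hy, hys, hya⟩ := hsl
      have hconv : Convex ℝ (D ∩ {x | ∀ i ∈ s, l i x ≤ 0}) := by
        refine hG.1.inter ?_
        simp only [ofPred_forall]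
        exact convex_iInter₂ fun i _ => convex_affine_le (l i)
      obtain ⟨d, hd, hdx⟩ := exists_multiplier_of_slater
        (hG.subset inter_subset_left hconv) (l a) ⟨hy, hys⟩ hya
        (fun x hx h => h0 x hx.1 ((Finset.forall_mem_insert _ _ _).2 ⟨h, hx.2⟩))
      obtain ⟨c, hc, hcx⟩ := ih D (fun x => G x + d * l a x)
        (convexOn_add_const_mul_affine hG (l a) d) hx₀ hcore hls
        (fun x hx h => hdx x ⟨hx, h⟩)
      exact combine c d hd hc hcx
    · push Not at hsl
      have hla : l a x₀ = 0 := le_antisymm (hl a (Finset.mem_insert_self a s)) (hsl x₀ hx₀ hls)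
      have hlconv : ConvexOn ℝ D (fun x => l a x) := by
        simpa using convexOn_add_const_mul_affine (convexOn_const 0 hG.1) (l a) 1
      obtain ⟨m, hm, hmx⟩ := ih D (fun x => l a x) hlconv hx₀ hcore hls hsl
      -- the nonnegative affine combination below vanishes at `x₀`, hence on all of `D`
      have hzero : ∀ x ∈ D, l a x + ∑ i ∈ s, m i * l i x = 0 := by
        intro x hx
        obtain ⟨ε, hε, hy⟩ := hcore x hx
        have hxε : x₀ + ε • (x₀ - x) = AffineMap.lineMap x₀ x (-ε) := by
          rw [AffineMap.lineMap_apply_module']; module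
        have happ : ∀ i, l i (x₀ + ε • (x₀ - x)) = (1 + ε) * l i x₀ - ε * l i x := by
          intro i
          rw [hxε, AffineMap.apply_lineMap, AffineMap.lineMap_apply_module']
          simp only [smul_eq_mul]
          ring
        have h1 := hmx x hx
        have h2 := hmx _ hy
        have h3 : ∑ i ∈ s, m i * l i x₀ ≤ 0 :=
          Finset.sum_nonpos fun i hi => mul_nonpos_of_nonneg_of_nonpos (hm i hi) (hls i hi)
        have h4 : ∑ i ∈ s, m i * l i (x₀ + ε • (x₀ - x)) =
            (1 + ε) * ∑ i ∈ s, m i * l i x₀ - ε * ∑ i ∈ s, m i * l i x := by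
          rw [Finset.mul_sum, Finset.mul_sum, ← Finset.sum_sub_distrib]
          exact Finset.sum_congr rfl fun i _ => by rw [happ]; ring
        rw [happ, h4, hla] at h2
        nlinarith
      obtain ⟨c, hc, hcx⟩ := ih (D ∩ {x | l a x = 0}) G
        (hG.subset inter_subset_left (hG.1.inter (convex_affine_eq _))) ⟨hx₀, hla⟩
        (relative_core_inter_eq hcore _ hla) hls
        (fun x hx h => h0 x hx.1 ((Finset.forall_mem_insert _ _ _).2 ⟨le_of_eq hx.2, h⟩))
      obtain ⟨d, hd⟩ := exists_multiplier_of_eq (G := fun x => G x + ∑ i ∈ s, c i * l i x)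
        (convexOn_add_sum_mul_affine hG l c s) hcore (l a) hla (fun x hx h => hcx x ⟨hx, h⟩)
      refine combine (fun i => c i + |d| * m i) (d + |d|) (by linarith [neg_abs_le d])
        (fun i hi => add_nonneg (hc i hi) (mul_nonneg (abs_nonneg d) (hm i hi))) fun x hx => ?_
      have h1 := hd x hx
      have h2 := hzero x hx
      have h3 : ∑ i ∈ s, (c i + |d| * m i) * l i x =
          ∑ i ∈ s, c i * l i x + |d| * ∑ i ∈ s, m i * l i x := by
        rw [Finset.mul_sum, ← Finset.sum_add_distrib]
        exact Finset.sum_congr rfl fun i _ => by ring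
      rw [h3]
      linear_combination h1 - |d| * h2

theorem relative_core_of_mem_intrinsicInterior {X : Type*} [NormedAddCommGroup X]
    [NormedSpace ℝ X] {D : Set X} {x₀ : X} (h : x₀ ∈ intrinsicInterior ℝ D) :
    ∀ x ∈ D, ∃ ε > (0 : ℝ), x₀ + ε • (x₀ - x) ∈ D := by
  intro x hx
  obtain ⟨y, hy, rfl⟩ := mem_intrinsicInterior.1 h
  let γ : ℝ → affineSpan ℝ D := fun t =>
    ⟨AffineMap.lineMap (y : X) x (-t),
      AffineMap.lineMap_mem _ y.2 (subset_affineSpan ℝ D hx)⟩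
  have hγ : Continuous γ := by
    refine Continuous.subtype_mk ?_ _
    exact AffineMap.lineMap_continuous.comp continuous_neg
  have hγ0 : γ 0 = y := Subtype.ext (by simp [γ])
  have hev : ∀ᶠ t in 𝓝 (0 : ℝ), γ t ∈ ((↑) ⁻¹' D : Set (affineSpan ℝ D)) :=
    hγ.continuousAt.eventually (by rw [hγ0]; exact mem_interior_iff_mem_nhds.1 hy)
  obtain ⟨ε, hmem, hε⟩ := ((hev.filter_mono nhdsWithin_le_nhds).and
    (self_mem_nhdsWithin : Ioi (0 : ℝ) ∈ 𝓝[>] 0)).exists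
  refine ⟨ε, hε, ?_⟩
  have h1 : AffineMap.lineMap (y : X) x (-ε) ∈ D := hmem
  rw [AffineMap.lineMap_apply_module'] at h1
  convert h1 using 1
  module

theorem exists_normal_of_relative_core {E : Type*} [NormedAddCommGroup E] [InnerProductSpace ℝ E]
    [FiniteDimensional ℝ E] {S D : Set E} {G : E → ℝ} (hS : Convex ℝ S) (hG : ConvexOn ℝ D G)
    {x₀ : E} (hcoreS : ∀ x ∈ S, ∃ ε > (0 : ℝ), x₀ + ε • (x₀ - x) ∈ S)
    (hcoreD : ∀ x ∈ D, ∃ ε > (0 : ℝ), x₀ + ε • (x₀ - x) ∈ D) (hxS : x₀ ∈ S) (hxD : x₀ ∈ D)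
    {a : E} (haS : a ∈ S) (haD : a ∈ D) (ha : G a = 0) (h0 : ∀ x ∈ D, x ∈ S → 0 ≤ G x) :
    ∃ w ∈ normalCone S a, ∀ x ∈ D, 0 ≤ G x + ⟪w, x - a⟫ := by
  let b := stdOrthonormalBasis ℝ E
  let l : Fin (Module.finrank ℝ E) → (E × E) →ᵃ[ℝ] ℝ := fun i =>
    ((innerₗ E (b i)).comp (LinearMap.fst ℝ E E - LinearMap.snd ℝ E E)).toAffineMap
  have hl : ∀ i z, l i z = ⟪b i, z.1 - z.2⟫ := fun i z => by simp [l]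
  have hcore : ∀ z ∈ D ×ˢ S, ∃ ε > (0 : ℝ), (x₀, x₀) + ε • ((x₀, x₀) - z) ∈ D ×ˢ S := by
    have shrink : ∀ {T : Set E}, Convex ℝ T → x₀ ∈ T → ∀ {x : E} {r s : ℝ}, 0 ≤ s → s ≤ r → 0 < r →
        x₀ + r • (x₀ - x) ∈ T → x₀ + s • (x₀ - x) ∈ T := by
      intro T hT hx x r s hs hsr hr hmem
      have := hT.add_smul_mem hx hmem ⟨div_nonneg hs hr.le, (div_le_one hr).2 hsr⟩
      rwa [smul_smul, div_mul_cancel₀ _ hr.ne'] at this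
    rintro ⟨x, y⟩ ⟨hx, hy⟩
    obtain ⟨r, hr, hr'⟩ := hcoreD x hx
    obtain ⟨s, hs, hs'⟩ := hcoreS y hy
    exact ⟨min r s, lt_min hr hs,
      shrink hG.1 hxD (lt_min hr hs).le (min_le_left _ _) hr hr',
      shrink hS hxS (lt_min hr hs).le (min_le_right _ _) hs hs'⟩
  have hGconv : ConvexOn ℝ (D ×ˢ S) (fun z => G z.1) :=
    ⟨hG.1.prod hS, fun z hz z' hz' r s hr hs hrs => hG.2 hz.1 hz'.1 hr hs hrs⟩
  obtain ⟨c, hc⟩ := exists_multipliers_of_eq l (x₀ := (x₀, x₀)) Finset.univ (D ×ˢ S) _ hGconv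
    hcore (fun i _ => by simp [hl]) (fun z hz hzl => by
      have : z.1 = z.2 := by
        rw [← sub_eq_zero, ← b.repr.map_eq_zero_iff]
        ext i
        simpa [b.repr_apply_apply, hl, inner_sub_right] using hzl i (Finset.mem_univ i)
      exact h0 _ hz.1 (this ▸ hz.2))
  have hc' : ∀ x ∈ D, ∀ y ∈ S, 0 ≤ G x + ⟪∑ i, c i • b i, x - y⟫ := by
    intro x hx y hy
    have := hc (x, y) ⟨hx, hy⟩
    simpa only [hl, sum_inner, real_inner_smul_left] using this
  refine ⟨∑ i, c i • b i, fun y hy => ?_, fun x hx => hc' x hx a haS⟩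
  have := hc' a haD y hy
  rw [ha, zero_add, ← neg_sub y a, inner_neg_right] at this
  linarith

theorem exists_normal_of_polyhedral {E : Type*} [NormedAddCommGroup E] [InnerProductSpace ℝ E]
    {S D : Set E} {G : E → ℝ} (hS : IsPolyhedral S) (hG : ConvexOn ℝ D G)
    {x₀ : E} (hcoreD : ∀ x ∈ D, ∃ ε > (0 : ℝ), x₀ + ε • (x₀ - x) ∈ D) (hxS : x₀ ∈ S) (hxD : x₀ ∈ D)
    {a : E} (haS : a ∈ S) (haD : a ∈ D) (ha : G a = 0) (h0 : ∀ x ∈ D, x ∈ S → 0 ≤ G x) :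
    ∃ w ∈ normalCone S a, ∀ x ∈ D, 0 ≤ G x + ⟪w, x - a⟫ := by
  obtain ⟨m, v, b, rfl⟩ := hS
  let l : Fin m → E →ᵃ[ℝ] ℝ := fun i => (innerₗ E (v i)).toAffineMap - AffineMap.const ℝ E (b i)
  have hl : ∀ i z, l i z = ⟪v i, z⟫ - b i := fun i z => by simp [l]
  have hmem : ∀ z, z ∈ {z | ∀ i, ⟪v i, z⟫ ≤ b i} ↔ ∀ i, l i z ≤ 0 := fun z => by simp [hl]
  rw [hmem] at hxS haS
  obtain ⟨c, hc, hcx⟩ := exists_multipliers_of_le l Finset.univ D G hG hxD hcoreD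
    (fun i _ => hxS i) (fun x hx h => h0 x hx ((hmem x).2 fun i => h i (Finset.mem_univ i)))
  have hsum : ∀ x, ⟪∑ i, c i • v i, x - a⟫ = ∑ i, c i * l i x - ∑ i, c i * l i a := by
    intro x
    rw [sum_inner, ← Finset.sum_sub_distrib]
    refine Finset.sum_congr rfl fun i _ => ?_
    rw [hl, hl, real_inner_smul_left, inner_sub_right]
    ring
  have hnonpos : ∀ x, (∀ i, l i x ≤ 0) → ∑ i, c i * l i x ≤ 0 := fun x hx =>
    Finset.sum_nonpos fun i hi => mul_nonpos_of_nonneg_of_nonpos (hc i hi) (hx i)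
  have hza : ∑ i, c i * l i a = 0 :=
    le_antisymm (hnonpos a haS) (by simpa [ha] using hcx a haD)
  refine ⟨∑ i, c i • v i, fun y hy => ?_, fun x hx => ?_⟩
  · rw [hsum, hza, sub_zero]
    exact hnonpos y ((hmem y).1 hy)
  · rw [hsum, hza, sub_zero]
    exact hcx x hx

theorem convexOn_toReal_edom {E : Type*} [AddCommGroup E] [Module ℝ E] {g : E → EReal}
    (hbot : ∀ x, g x ≠ ⊥) (hg : ERealConvex g) : ConvexOn ℝ (edom g) (fun x => (g x).toReal) := by
  have key : ∀ x ∈ edom g, ∀ y ∈ edom g, ∀ a b : ℝ, 0 ≤ a → 0 ≤ b → a + b = 1 →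
      g (a • x + b • y) ≤ ((a * (g x).toReal + b * (g y).toReal : ℝ) : EReal) := by
    intro x hx y hy a b ha hb hab
    have := hg x y a b ha hb hab
    rw [← EReal.coe_toReal hx (hbot x), ← EReal.coe_toReal hy (hbot y)] at this
    exact_mod_cast this
  have hdom : Convex ℝ (edom g) := fun x hx y hy a b ha hb hab =>
    ((key x hx y hy a b ha hb hab).trans_lt (EReal.coe_lt_top _)).ne
  refine ⟨hdom, fun x hx y hy a b ha hb hab => ?_⟩
  have := key x hx y hy a b ha hb hab
  rw [← EReal.coe_toReal (hdom hx hy ha hb hab) (hbot _)] at this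
  exact_mod_cast this

theorem mem_csubdiff_iff_toReal {E : Type*} [NormedAddCommGroup E] [InnerProductSpace ℝ E]
    {g : E → EReal} (hbot : ∀ x, g x ≠ ⊥) {a : E} (ha : a ∈ edom g) (v : E) :
    v ∈ csubdiff g a ↔ ∀ x ∈ edom g, (g a).toReal + ⟪v, x - a⟫ ≤ (g x).toReal := by
  refine ⟨fun h x hx => ?_, fun h x => ?_⟩
  · have := h x
    rw [← EReal.coe_toReal ha (hbot a), ← EReal.coe_toReal hx (hbot x)] at this
    exact_mod_cast this
  · by_cases hx : x ∈ edom g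
    · rw [← EReal.coe_toReal ha (hbot a), ← EReal.coe_toReal hx (hbot x)]
      exact_mod_cast h x hx
    · rw [show g x = ⊤ from not_not.1 hx]
      exact le_top

/-- The subdifferential sum rule for a convex function and the indicator of a convex set. -/
theorem exists_csubdiff_add_normalCone_iff {E : Type*} [NormedAddCommGroup E]
    [InnerProductSpace ℝ E] [FiniteDimensional ℝ E] {S : Set E} {g : E → EReal}
    (hS : Convex ℝ S) (hbot : ∀ x, g x ≠ ⊥) (hg : ERealConvex g)
    (hqual : (intrinsicInterior ℝ S ∩ intrinsicInterior ℝ (edom g)).Nonempty ∨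
      (IsPolyhedral S ∧ (S ∩ intrinsicInterior ℝ (edom g)).Nonempty))
    {a : E} (haS : a ∈ S) (ha : a ∈ edom g) (ξ : E) :
    (∃ v ∈ csubdiff g a, ∃ w ∈ normalCone S a, v + w = ξ) ↔
      ∀ x ∈ edom g, x ∈ S → (g a).toReal + ⟪ξ, x - a⟫ ≤ (g x).toReal := by
  constructor
  · rintro ⟨v, hv, w, hw, rfl⟩ x hx hxS
    have h1 := (mem_csubdiff_iff_toReal hbot ha v).1 hv x hx
    have h2 := hw x hxS
    rw [inner_add_left]
    linarith
  · intro h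
    let l : E →ᵃ[ℝ] ℝ := (innerₗ E ξ).toAffineMap - AffineMap.const ℝ E (⟪ξ, a⟫ - (g a).toReal)
    have hl : ∀ x, l x = ⟪ξ, x - a⟫ + (g a).toReal := fun x => by
      simp [l, inner_sub_right]; ring
    have hG := convexOn_add_const_mul_affine (convexOn_toReal_edom hbot hg) l (-1)
    have hGa : (g a).toReal + -1 * l a = 0 := by simp [hl]
    have h0 : ∀ x ∈ edom g, x ∈ S → 0 ≤ (g x).toReal + -1 * l x := fun x hx hxS => by
      rw [hl]; linarith [h x hx hxS]
    have key : ∃ w ∈ normalCone S a, ∀ x ∈ edom g,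
        0 ≤ (g x).toReal + -1 * l x + ⟪w, x - a⟫ := by
      rcases hqual with ⟨x₀, hx₀S, hx₀⟩ | ⟨hpoly, x₀, hx₀S, hx₀⟩
      · exact exists_normal_of_relative_core hS hG (relative_core_of_mem_intrinsicInterior hx₀S)
          (relative_core_of_mem_intrinsicInterior hx₀) (intrinsicInterior_subset hx₀S)
          (intrinsicInterior_subset hx₀) haS ha hGa h0
      · exact exists_normal_of_polyhedral hpoly hG (relative_core_of_mem_intrinsicInterior hx₀)
          hx₀S (intrinsicInterior_subset hx₀) haS ha hGa h0
    obtain ⟨w, hw, hwx⟩ := key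
    refine ⟨ξ - w, (mem_csubdiff_iff_toReal hbot ha _).2 fun x hx => ?_, w, hw, by simp⟩
    have := hwx x hx
    rw [hl] at this
    rw [inner_sub_left]
    linarith

/-- `l` is a Fréchet subgradient at `a` of the function equal to `φ` on `A` and `+∞` off `A`. -/
def IsFrechetSubgradientWithin {X : Type*} [NormedAddCommGroup X] [NormedSpace ℝ X]
    (φ : X → ℝ) (l : X →L[ℝ] ℝ) (A : Set X) (a : X) : Prop :=
  ∀ ε > (0 : ℝ), ∀ᶠ w in 𝓝[A] a, φ a + l (w - a) - ε * ‖w - a‖ ≤ φ w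

namespace IsFrechetSubgradientWithin

variable {X : Type*} [NormedAddCommGroup X] [NormedSpace ℝ X] {φ ψ : X → ℝ} {l l' : X →L[ℝ] ℝ}
  {A : Set X} {a : X}

theorem congr_of_eqOn (h : IsFrechetSubgradientWithin φ l A a) (ha : φ a = ψ a)
    (heq : ∀ᶠ w in 𝓝[A] a, φ w = ψ w) : IsFrechetSubgradientWithin ψ l A a := by
  intro ε hε
  filter_upwards [h ε hε, heq] with w hw hw'
  rwa [← ha, ← hw']

theorem add_hasFDerivAt (h : IsFrechetSubgradientWithin φ l A a) (hψ : HasFDerivAt ψ l' a) :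
    IsFrechetSubgradientWithin (fun w => φ w + ψ w) (l + l') A a := by
  intro ε hε
  have hψε := (hψ.isLittleO.def (half_pos hε)).filter_mono (nhdsWithin_le_nhds (s := A))
  filter_upwards [h (ε / 2) (half_pos hε), hψε] with w hw hw'
  have h1 := (abs_le.1 hw').1
  simp only [add_apply]
  linarith

theorem mul_hasFDerivAt (h : IsFrechetSubgradientWithin φ l A a) (hψ : HasFDerivAt ψ l' a)
    (hpos : 0 < ψ a) :
    IsFrechetSubgradientWithin (fun w => φ w * ψ w) (ψ a • l + φ a • l') A a := by
  intro ε hε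
  set η : ℝ := ε / (2 * ψ a + |φ a| + ‖l‖ + 1) with hηdef
  have hden : 0 < 2 * ψ a + |φ a| + ‖l‖ + 1 := by positivity
  have hη : 0 < η := div_pos hε hden
  have hηε : η * (2 * ψ a + |φ a| + ‖l‖ + 1) = ε := div_mul_cancel₀ _ hden.ne'
  have hψη := (hψ.isLittleO.def hη).filter_mono (nhdsWithin_le_nhds (s := A))
  have hcont : ∀ᶠ w in 𝓝[A] a, |ψ w - ψ a| < min η (ψ a) := by
    have := hψ.continuousAt.eventually (Metric.ball_mem_nhds (ψ a) (lt_min hη hpos))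
    filter_upwards [this.filter_mono (nhdsWithin_le_nhds (s := A))] with w hw
    simpa [Real.dist_eq] using hw
  filter_upwards [h η hη, hψη, hcont] with w hw hw' hwc
  have hc1 := abs_lt.1 (hwc.trans_le (min_le_right _ _))
  have hc2 := (hwc.trans_le (min_le_left _ _)).le
  set N := ‖w - a‖
  have hN : 0 ≤ N := norm_nonneg _
  have hlw : |l (w - a)| ≤ ‖l‖ * N := l.le_opNorm _
  have e1 : ψ w * (φ a + l (w - a) - η * N) ≤ ψ w * φ w :=
    mul_le_mul_of_nonneg_left hw (by linarith)
  have e2 : -(η * (‖l‖ * N)) ≤ (ψ w - ψ a) * l (w - a) := by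
    refine (abs_le.1 ?_).1
    rw [abs_mul]
    exact mul_le_mul hc2 hlw (abs_nonneg _) hη.le
  have e3 : -(|φ a| * (η * N)) ≤ φ a * (ψ w - ψ a - l' (w - a)) := by
    refine (abs_le.1 ?_).1
    rw [abs_mul]
    exact mul_le_mul_of_nonneg_left hw' (abs_nonneg _)
  have e4 : ψ w * (η * N) ≤ 2 * ψ a * (η * N) :=
    mul_le_mul_of_nonneg_right (by linarith) (by positivity)
  have e5 : 0 ≤ η * N := by positivity
  have e6 : ε * N = 2 * ψ a * (η * N) + |φ a| * (η * N) + η * (‖l‖ * N) + η * N := by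
    rw [← hηε]; ring
  simp only [add_apply, smul_apply, smul_eq_mul]
  rw [e6]
  linarith

/-- A Fréchet subgradient of a convex function is a global subgradient. -/
theorem add_le_of_convexOn (h : IsFrechetSubgradientWithin φ l A a) (hφ : ConvexOn ℝ A φ)
    (ha : a ∈ A) {x : X} (hx : x ∈ A) : φ a + l (x - a) ≤ φ x := by
  have key : ∀ ε > (0 : ℝ), φ a + l (x - a) - ε * ‖x - a‖ ≤ φ x := by
    intro ε hε
    have hcont : Continuous fun t : ℝ => a + t • (x - a) := by fun_prop
    have htend : Tendsto (fun t : ℝ => a + t • (x - a)) (𝓝[>] 0) (𝓝[A] a) := by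
      refine tendsto_nhdsWithin_iff.2 ⟨?_, ?_⟩
      · exact (hcont.tendsto' 0 a (by simp)).mono_left nhdsWithin_le_nhds
      · filter_upwards [Ioo_mem_nhdsGT (zero_lt_one' ℝ)] with t ht
        exact hφ.1.add_smul_sub_mem ha hx ⟨ht.1.le, ht.2.le⟩
    obtain ⟨t, ht, ht01⟩ :=
      ((htend.eventually (h ε hε)).and (Ioo_mem_nhdsGT (zero_lt_one' ℝ))).exists
    have hconv := hφ.2 ha hx (sub_nonneg.2 ht01.2.le) ht01.1.le (sub_add_cancel 1 t)
    have hpt : (1 - t) • a + t • x = a + t • (x - a) := by module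
    rw [hpt] at hconv
    rw [add_sub_cancel_left, map_smul, norm_smul, Real.norm_of_nonneg ht01.1.le] at ht
    simp only [smul_eq_mul] at ht hconv
    have : 0 ≤ t * (φ x - (φ a + l (x - a) - ε * ‖x - a‖)) := by linarith
    linarith [(mul_nonneg_iff_of_pos_left ht01.1).1 this]
  refine le_of_forall_pos_le_add fun ε hε => ?_
  have h1 := key (ε / (‖x - a‖ + 1)) (by positivity)
  have h2 : ε / (‖x - a‖ + 1) * ‖x - a‖ ≤ ε := by
    rw [div_mul_eq_mul_div, div_le_iff₀ (by positivity)]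
    nlinarith [norm_nonneg (x - a)]
  linarith

theorem of_forall_le (h : ∀ x ∈ A, φ a + l (x - a) ≤ φ x) :
    IsFrechetSubgradientWithin φ l A a := by
  intro ε hε
  filter_upwards [self_mem_nhdsWithin] with w hw
  have := h w hw
  have : 0 ≤ ε * ‖w - a‖ := by positivity
  linarith

end IsFrechetSubgradientWithin

section

variable {X : Type*} [NormedAddCommGroup X] [NormedSpace ℝ X] {φ ψ : X → ℝ} {l l' : X →L[ℝ] ℝ}
  {A : Set X} {a : X}

theorem isFrechetSubgradientWithin_add_iff (hψ : HasFDerivAt ψ l' a) :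
    IsFrechetSubgradientWithin (fun w => φ w + ψ w) l A a ↔
      IsFrechetSubgradientWithin φ (l - l') A a := by
  constructor
  · intro h
    simpa [sub_eq_add_neg] using h.add_hasFDerivAt hψ.neg
  · intro h
    simpa using h.add_hasFDerivAt hψ

theorem isFrechetSubgradientWithin_div_iff (hψ : HasFDerivAt ψ l' a) (hpos : 0 < ψ a) :
    IsFrechetSubgradientWithin (fun w => φ w / ψ w) l A a ↔
      IsFrechetSubgradientWithin φ (ψ a • l + (φ a / ψ a) • l') A a := by
  have hne : ∀ᶠ w in 𝓝[A] a, ψ w ≠ 0 :=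
    (hψ.continuousAt.eventually_ne hpos.ne').filter_mono nhdsWithin_le_nhds
  constructor
  · intro h
    refine (h.mul_hasFDerivAt hψ hpos).congr_of_eqOn (div_mul_cancel₀ _ hpos.ne') ?_
    filter_upwards [hne] with w hw using div_mul_cancel₀ _ hw
  · intro h
    have h1 := h.mul_hasFDerivAt ((hasDerivAt_inv hpos.ne').comp_hasFDerivAt a hψ) (inv_pos.2 hpos)
    have hl : (ψ a)⁻¹ • (ψ a • l + (φ a / ψ a) • l') + φ a • (-(ψ a ^ 2)⁻¹) • l' = l := by
      ext w
      simp only [add_apply, smul_apply, smul_eq_mul]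
      field_simp
      ring
    exact hl ▸ h1

theorem isFrechetSubgradientWithin_prod_iff {Y : Type*} [NormedAddCommGroup Y] [NormedSpace ℝ Y]
    (hφ : ConvexOn ℝ A φ) (ha : a ∈ A) (b : Y) (L : X × Y →L[ℝ] ℝ) :
    IsFrechetSubgradientWithin (fun w : X × Y => φ w.1) L (A ×ˢ univ) (a, b) ↔
      (∀ x ∈ A, φ a + L (x - a, 0) ≤ φ x) ∧ ∀ y, L (0, y) = 0 := by
  constructor
  · intro h
    have hconv : ConvexOn ℝ (A ×ˢ (univ : Set Y)) (fun w => φ w.1) :=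
      ⟨hφ.1.prod convex_univ, fun z hz z' hz' r s hr hs hrs => hφ.2 hz.1 hz'.1 hr hs hrs⟩
    have key : ∀ x ∈ A, ∀ y, φ a + L (x - a, y) ≤ φ x := by
      intro x hx y
      simpa using h.add_le_of_convexOn hconv ⟨ha, mem_univ b⟩
        (⟨hx, mem_univ (b + y)⟩ : (x, b + y) ∈ A ×ˢ (univ : Set Y))
    refine ⟨fun x hx => key x hx 0, fun y => ?_⟩
    have h1 : L (0, y) ≤ 0 := by simpa using key a ha y
    have h2 : -L (0, y) ≤ 0 := by
      rw [← map_neg]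
      simpa using key a ha (-y)
    linarith
  · rintro ⟨h1, h2⟩
    refine IsFrechetSubgradientWithin.of_forall_le fun w hw => ?_
    have : w - (a, b) = (w.1 - a, 0) + (0, w.2 - b) := by ext <;> simp
    rw [this, map_add, h2, add_zero]
    exact h1 w.1 hw.1

end

/-- The `EReal`-valued definition of the Fréchet subdifferential agrees with the real one when the
function is locally real on `A` and `⊤` off `A`. -/
theorem mem_fsub2_iff {E F : Type*} [NormedAddCommGroup E] [InnerProductSpace ℝ E]
    [NormedAddCommGroup F] [InnerProductSpace ℝ F] {Φ : E → F → EReal} {φ : E × F → ℝ}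
    {A : Set (E × F)} {a : E} {b : F} (ha : (a, b) ∈ A)
    (hA : ∀ᶠ w in 𝓝 (a, b), w ∈ A → Φ w.1 w.2 = (φ w : EReal))
    (hA' : ∀ᶠ w in 𝓝 (a, b), w ∉ A → Φ w.1 w.2 = ⊤) (v : E × F) :
    v ∈ fsub2 Φ a b ↔ IsFrechetSubgradientWithin φ
      ((innerSL ℝ v.1).comp (ContinuousLinearMap.fst ℝ E F) +
        (innerSL ℝ v.2).comp (ContinuousLinearMap.snd ℝ E F)) A (a, b) := by
  have hab : Φ a b = (φ (a, b) : EReal) := hA.self_of_nhds ha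
  set q : E × F → EReal := fun w =>
    (Φ w.1 w.2 - Φ a b - ((⟪v.1, w.1 - a⟫ + ⟪v.2, w.2 - b⟫ : ℝ) : EReal)) *
          (((‖w - (a, b)‖)⁻¹ : ℝ) : EReal) with hq
  have hqA : ∀ᶠ w in 𝓝 (a, b), w ∈ A → q w =
      (((φ w - φ (a, b) - (⟪v.1, w.1 - a⟫ + ⟪v.2, w.2 - b⟫)) * ‖w - (a, b)‖⁻¹ : ℝ) : EReal) := by
    filter_upwards [hA] with w hw hwA
    simp only [hq]
    rw [hw hwA, hab]
    norm_cast
  have hqA' : ∀ᶠ w in 𝓝[≠] (a, b), w ∉ A → q w = ⊤ := by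
    filter_upwards [hA'.filter_mono nhdsWithin_le_nhds, self_mem_nhdsWithin] with w hw hne hwA
    simp only [hq]
    rw [hw hwA, hab, EReal.top_sub_coe, EReal.top_sub_coe]
    exact EReal.top_mul_coe_of_pos (inv_pos.2 (norm_pos_iff.2 (sub_ne_zero.2 hne)))
  have hiff : v ∈ fsub2 Φ a b ↔ ∀ y < (0 : EReal), ∀ᶠ w in 𝓝[≠] (a, b), y < q w :=
    Filter.le_liminf_iff (f := 𝓝[≠] (a, b)) (u := q)
  rw [hiff]
  constructor
  · intro h ε hε
    have h1 := eventually_nhdsWithin_iff.1 (h ((-ε : ℝ) : EReal) (by exact_mod_cast neg_lt_zero.2 hε))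
    rw [eventually_nhdsWithin_iff]
    filter_upwards [h1, hqA] with w hw1 hw2 hwA
    by_cases hne : w = (a, b)
    · simp [hne]
    · have h3 := hw1 hne
      rw [hw2 hwA, EReal.coe_lt_coe_iff, ← div_eq_mul_inv,
        lt_div_iff₀ (norm_pos_iff.2 (sub_ne_zero.2 hne))] at h3
      simp
      linarith
  · intro h y hy
    obtain ⟨r, hyr, hr⟩ := EReal.lt_iff_exists_real_btwn.1 hy
    have hr' : r < 0 := by exact_mod_cast hr
    have h1 := eventually_nhdsWithin_iff.1 (h (-r / 2) (by linarith))
    filter_upwards [h1.filter_mono nhdsWithin_le_nhds, hqA.filter_mono nhdsWithin_le_nhds, hqA',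
      self_mem_nhdsWithin] with w hw1 hw2 hw3 hne
    by_cases hwA : w ∈ A
    · refine hyr.trans ?_
      have hpos : 0 < ‖w - (a, b)‖ := norm_pos_iff.2 (sub_ne_zero.2 hne)
      have h4 := hw1 hwA
      rw [hw2 hwA, EReal.coe_lt_coe_iff, ← div_eq_mul_inv, lt_div_iff₀ hpos]
      simp at h4
      nlinarith
    · rw [hw3 hwA]
      exact hy.trans_le le_top

theorem phiF_eq_coe {n : ℕ} {S : Set (EuclideanSpace ℝ (Fin n))}
    {g : EuclideanSpace ℝ (Fin n) → EReal} (hbot : ∀ x, g x ≠ ⊥)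
    (h : EuclideanSpace ℝ (Fin n) → ℝ) (δ : ℝ) {x : EuclideanSpace ℝ (Fin n)}
    (u : EuclideanSpace ℝ (Fin n)) (hx : x ∈ S ∩ edom g) :
    phiF S g h δ x u = (((g x).toReal + (h x + (2 * δ)⁻¹ * ‖x - u‖ ^ 2) : ℝ) : EReal) := by
  rw [phiF, if_pos hx.1, add_zero, ← EReal.coe_toReal hx.2 (hbot x), EReal.toReal_coe]
  norm_cast
  rw [add_assoc]

theorem phiF_eq_top {n : ℕ} {S : Set (EuclideanSpace ℝ (Fin n))}
    {g : EuclideanSpace ℝ (Fin n) → EReal} (hbot : ∀ x, g x ≠ ⊥)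
    (h : EuclideanSpace ℝ (Fin n) → ℝ) (δ : ℝ) {x : EuclideanSpace ℝ (Fin n)}
    (u : EuclideanSpace ℝ (Fin n)) (hx : x ∉ S ∩ edom g) : phiF S g h δ x u = ⊤ := by
  have hgh : g x + (h x : EReal) ≠ ⊥ := by simp [EReal.add_eq_bot_iff, hbot x]
  by_cases hxS : x ∈ S
  · have hg : g x = ⊤ := not_not.1 fun hg => hx ⟨hxS, hg⟩
    rw [phiF, if_pos hxS, hg, EReal.top_add_coe, add_zero, EReal.top_add_coe]
  · rw [phiF, if_neg hxS, EReal.add_top_of_ne_bot hgh, EReal.top_add_coe]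

theorem stmt14 {n p : ℕ}
    (S : Set (EuclideanSpace ℝ (Fin n)))
    (g : EuclideanSpace ℝ (Fin n) → EReal)
    (h : EuclideanSpace ℝ (Fin n) → ℝ)
    (gh : EuclideanSpace ℝ (Fin n) → EuclideanSpace ℝ (Fin n))
    (f : EuclideanSpace ℝ (Fin p) → EReal)
    (K : EuclideanSpace ℝ (Fin n) →ₗ[ℝ] EuclideanSpace ℝ (Fin p))
    (L δ : ℝ)
    (hS : S.Nonempty) (hSconv : Convex ℝ S) (hScomp : IsCompact S)
    (hgP : ERealProper g) (hgconv : ERealConvex g) (hglsc : LowerSemicontinuous g)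
    (hfP : ERealProper f) (hfconv : ERealConvex f) (hflsc : LowerSemicontinuous f)
    (hL : 0 < L)
    (hhC1 : ∃ O : Set (EuclideanSpace ℝ (Fin n)), IsOpen O ∧ S ⊆ O ∧
      (∀ z ∈ O, HasGradientAt h (gh z) z) ∧
      (∀ z ∈ O, ∀ w ∈ O, ‖gh z - gh w‖ ≤ L * ‖z - w‖))
    (hKS : ∀ z ∈ S, K z ∈ interior (edom f))
    (hfpos : ∀ z ∈ S, (0 : EReal) < f (K z))
    (hghnn : ∀ z ∈ S, (0 : EReal) ≤ g z + ((h z : ℝ) : EReal))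
    (hSg : ∃ z ∈ S, g z ≠ ⊤)
    (hδ : 0 < δ) (hδL : δ < 1 / L)
    (hA2 : (intrinsicInterior ℝ S ∩ intrinsicInterior ℝ (edom g)).Nonempty ∨
      (IsPolyhedral S ∧ (S ∩ intrinsicInterior ℝ (edom g)).Nonempty))
    (xp up : EuclideanSpace ℝ (Fin n)) (hxp : xp ∈ S)
    (fr : EuclideanSpace ℝ (Fin p) → ℝ) (gf : EuclideanSpace ℝ (Fin p))
    (hfr : ∃ V : Set (EuclideanSpace ℝ (Fin p)), IsOpen V ∧ K xp ∈ V ∧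
      (∀ w ∈ V, f w = ((fr w : ℝ) : EReal)) ∧ HasGradientAt fr gf (K xp))
    (hα₁pos : (0 : EReal) < phiF S g h δ xp up)
    (hα₁fin : phiF S g h δ xp up ≠ ⊤)
    :
    fsub2 (fun a b => varthetaF S g h f K δ a b) xp up
      = {v : EuclideanSpace ℝ (Fin n) × EuclideanSpace ℝ (Fin n) |
          (∃ vg ∈ csubdiff g xp, ∃ w ∈ normalCone S xp,
            v.1 = (((f (K xp)).toReal) ^ 2)⁻¹ •
              ((f (K xp)).toReal • (vg + gh xp + w + δ⁻¹ • (xp - up))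
                - (phiF S g h δ xp up).toReal • (LinearMap.adjoint K) gf))
          ∧ v.2 = (δ * (f (K xp)).toReal)⁻¹ • (up - xp)} := by
  have hbot := hgP.1
  obtain ⟨O, -, hSO, hgrad, -⟩ := hhC1
  obtain ⟨V, hVopen, hKV, hfV, hfgrad⟩ := hfr
  have hxA : xp ∈ S ∩ edom g := by
    by_contra hx
    exact hα₁fin (phiF_eq_top hbot h δ up hx)
  have hfK : f (K xp) = (fr (K xp) : EReal) := hfV _ hKV
  have hα₂ : 0 < fr (K xp) := by
    have := hfpos xp hxp
    rw [hfK] at this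
    exact_mod_cast this
  have hφ := phiF_eq_coe hbot h δ up hxA
  let Kc : EuclideanSpace ℝ (Fin n) →L[ℝ] EuclideanSpace ℝ (Fin p) :=
    LinearMap.toContinuousLinearMap K
  let φ : EuclideanSpace ℝ (Fin n) × EuclideanSpace ℝ (Fin n) → ℝ := fun w =>
    (g w.1).toReal + (h w.1 + (2 * δ)⁻¹ * ‖w.1 - w.2‖ ^ 2)
  let q : EuclideanSpace ℝ (Fin n) × EuclideanSpace ℝ (Fin n) → ℝ := fun w => fr (Kc w.1)
  obtain ⟨dψ, hψ, hdψ⟩ : ∃ dψ, HasFDerivAt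
      (fun w : EuclideanSpace ℝ (Fin n) × EuclideanSpace ℝ (Fin n) =>
        h w.1 + (2 * δ)⁻¹ * ‖w.1 - w.2‖ ^ 2) dψ (xp, up) ∧
      ∀ d e, dψ (d, e) = ⟪gh xp + δ⁻¹ • (xp - up), d⟫ - ⟪δ⁻¹ • (xp - up), e⟫ := by
    refine ⟨_, ((hgrad xp (hSO hxp)).hasFDerivAt.comp (xp, up) hasFDerivAt_fst).add
      (((hasFDerivAt_fst (𝕜 := ℝ) (p := (xp, up))).sub hasFDerivAt_snd).norm_sq.const_mul
        (2 * δ)⁻¹), fun d e => ?_⟩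
    simp [inner_add_left, real_inner_smul_left, inner_sub_left]
    ring
  obtain ⟨dq, hq, hdq⟩ : ∃ dq : EuclideanSpace ℝ (Fin n) × EuclideanSpace ℝ (Fin n) →L[ℝ] ℝ,
      HasFDerivAt q dq (xp, up) ∧ ∀ d e, dq (d, e) = ⟪LinearMap.adjoint K gf, d⟫ := by
    refine ⟨_, HasFDerivAt.comp (xp, up)
      (f := Kc.comp (ContinuousLinearMap.fst ℝ (EuclideanSpace ℝ (Fin n))
        (EuclideanSpace ℝ (Fin n)))) hfgrad.hasFDerivAt
      (ContinuousLinearMap.hasFDerivAt _), fun d e => ?_⟩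
    simp [Kc, LinearMap.adjoint_inner_left]
  have hKcont : ContinuousAt (fun w : EuclideanSpace ℝ (Fin n) × EuclideanSpace ℝ (Fin n) => Kc w.1)
      (xp, up) := by fun_prop
  have hVev : ∀ᶠ w in 𝓝 ((xp, up) : EuclideanSpace ℝ (Fin n) × EuclideanSpace ℝ (Fin n)),
      f (K w.1) = (q w : EReal) := by
    filter_upwards [hKcont.eventually (hVopen.mem_nhds hKV)] with w hw using hfV _ hw
  have hqpos : ∀ᶠ w in 𝓝 ((xp, up) : EuclideanSpace ℝ (Fin n) × EuclideanSpace ℝ (Fin n)),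
      0 < q w :=
    hq.continuousAt.eventually (lt_mem_nhds hα₂)
  have hreal : ∀ᶠ w in 𝓝 ((xp, up) : EuclideanSpace ℝ (Fin n) × EuclideanSpace ℝ (Fin n)),
      w ∈ (S ∩ edom g) ×ˢ (univ : Set (EuclideanSpace ℝ (Fin n))) →
      varthetaF S g h f K δ w.1 w.2 = ((φ w / q w : ℝ) : EReal) := by
    filter_upwards [hVev] with w hw hwA
    rw [varthetaF, phiF_eq_coe hbot h δ w.2 hwA.1, hw, EReal.coe_div]
  have htop : ∀ᶠ w in 𝓝 ((xp, up) : EuclideanSpace ℝ (Fin n) × EuclideanSpace ℝ (Fin n)),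
      w ∉ (S ∩ edom g) ×ˢ (univ : Set (EuclideanSpace ℝ (Fin n))) →
      varthetaF S g h f K δ w.1 w.2 = ⊤ := by
    filter_upwards [hVev, hqpos] with w hw hw' hwA
    rw [varthetaF, phiF_eq_top hbot h δ w.2 fun hx => hwA ⟨hx, mem_univ _⟩, hw]
    exact EReal.top_div_of_pos_ne_top (by exact_mod_cast hw') (EReal.coe_ne_top _)
  have hgconvS : ConvexOn ℝ (S ∩ edom g) (fun x => (g x).toReal) :=
    (convexOn_toReal_edom hbot hgconv).subset inter_subset_right
      (hSconv.inter (convexOn_toReal_edom hbot hgconv).1)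
  ext ⟨v₁, v₂⟩
  rw [mem_fsub2_iff (φ := fun w => φ w / q w) (mk_mem_prod hxA (mem_univ up)) hreal htop,
    isFrechetSubgradientWithin_div_iff hq hα₂, isFrechetSubgradientWithin_add_iff hψ,
    isFrechetSubgradientWithin_prod_iff hgconvS hxA, mem_ofPred_eq, hφ, hfK, EReal.toReal_coe,
    EReal.toReal_coe]
  set α₁ : ℝ := (g xp).toReal + (h xp + (2 * δ)⁻¹ * ‖xp - up‖ ^ 2) with hα₁
  set α₂ : ℝ := fr (K xp)
  have hφα : φ (xp, up) = α₁ := rfl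
  have hqα : q (xp, up) = α₂ := rfl
  rw [hφα, hqα]
  set ξ : EuclideanSpace ℝ (Fin n) :=
    α₂ • v₁ + (α₁ / α₂) • LinearMap.adjoint K gf - gh xp - δ⁻¹ • (xp - up) with hξ
  obtain ⟨Λ, hΛ⟩ : ∃ Λ : EuclideanSpace ℝ (Fin n) × EuclideanSpace ℝ (Fin n) →L[ℝ] ℝ,
      Λ = α₂ • ((innerSL ℝ v₁).comp (ContinuousLinearMap.fst ℝ _ _) +
        (innerSL ℝ v₂).comp (ContinuousLinearMap.snd ℝ _ _)) + (α₁ / α₂) • dq - dψ := ⟨_, rfl⟩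
  have hL : ∀ d e, Λ (d, e) = ⟪ξ, d⟫ + ⟪α₂ • v₂ - δ⁻¹ • (up - xp), e⟫ := by
    intro d e
    simp [hΛ, hdψ, hdq, hξ, inner_add_left, inner_sub_left, real_inner_smul_left]
    ring
  rw [← hΛ]
  simp only [hL, inner_zero_right, add_zero, zero_add]
  refine and_congr ?_ ?_
  · have hsum := exists_csubdiff_add_normalCone_iff hSconv hbot hgconv hA2 hxp hxA.2 ξ
    rw [show (∀ x ∈ S ∩ edom g, (g xp).toReal + ⟪ξ, x - xp⟫ ≤ (g x).toReal) ↔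
      ∀ x ∈ edom g, x ∈ S → (g xp).toReal + ⟪ξ, x - xp⟫ ≤ (g x).toReal from
        ⟨fun H x hx hxS => H x ⟨hxS, hx⟩, fun H x hx => H x hx.2 hx.1⟩, ← hsum]
    refine exists_congr fun vg => and_congr_right fun _ => exists_congr fun w =>
      and_congr_right fun _ => ?_
    rw [hξ]
    constructor
    · intro H
      have : α₂ • v₁ = vg + gh xp + w + δ⁻¹ • (xp - up) - (α₁ / α₂) • LinearMap.adjoint K gf := by
        rw [eq_sub_iff_add_eq, ← sub_eq_iff_eq_add, ← sub_eq_zero]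
        rw [← sub_eq_zero] at H
        rw [← neg_eq_zero, ← H]
        abel
      rw [eq_inv_smul_iff₀ (by positivity), pow_two, mul_smul, this, smul_sub, smul_smul,
        mul_div_cancel₀ _ hα₂.ne']
    · intro H
      rw [H]
      match_scalars <;> field_simp <;> ring
  · rw [eq_inv_smul_iff₀ (by positivity), mul_smul, ← eq_inv_smul_iff₀ hδ.ne', ← sub_eq_zero]
    exact ⟨fun H => inner_self_eq_zero.1 (H _), fun H y => by rw [H, inner_zero_left]⟩
end
end
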